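/- Let B be a finite nonempty set and M ⊆ (ℕ^B) an upper set (meaning x ∈ M and x ≤ y pointwise implies y ∈ M). For T, U nonnegative integers with T ≥ U and x ≥ 0 a real number, if μ_T(M) ≤ T/(T+x) then μ_U(M) ≤ U/(U+x), where μ_T denotes the uniform probability measure on the set of functions f : B → ℕ with total sum T (with the convention 0/0 = 1 when U = x = 0). -/

import Mathlib

open Finset

/-- The uniform probability of the event `M` under the uniform distribution on
functions `f : B → ℕ` with `∑ b, f b = T`. -/
noncomputable def uniformProb (B : Type*) [Fintype B] (T : ℕ) (M : Set (B → ℕ)) : ℝ := by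
  classical
  exact (((Fintype.piFinset fun _ : B => Finset.range (T + 1)).filter
        (fun f => (∑ b, f b) = T ∧ f ∈ M)).card : ℝ) /
      (((Fintype.piFinset fun _ : B => Finset.range (T + 1)).filter
        (fun f => (∑ b, f b) = T)).card : ℝ)

open Classical in
/-- number of elements of `M` at level `T` supported on `S` -/
noncomputable def cnt {ι : Type*} [DecidableEq ι] (M : Set (ι → ℕ)) (S : Finset ι) (T : ℕ) : ℕ :=
  ∑ f ∈ piAntidiag S T, if f ∈ M then 1 else 0

/-- colon set -/
def colon {ι : Type*} [DecidableEq ι] (M : Set (ι → ℕ)) (b : ι) : Set (ι → ℕ) :=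
  {g | g + Pi.single b 1 ∈ M}

/-- closed under adding one element -/
def IsUp {ι : Type*} [DecidableEq ι] (M : Set (ι → ℕ)) : Prop :=
  ∀ f ∈ M, ∀ c, f + Pi.single c 1 ∈ M

lemma sum_ne_zero_shift {ι : Type*} [DecidableEq ι] (S : Finset ι) (T : ℕ) (c : ι) (hc : c ∈ S)
    (G : (ι → ℕ) → ℕ) :
    ∑ f ∈ (piAntidiag S (T+1)).filter (fun f => f c ≠ 0), G f
      = ∑ g ∈ piAntidiag S T, G (g + Pi.single c 1) := by
  have key : ∀ f : ι → ℕ, f c ≠ 0 → f - Pi.single c 1 + Pi.single c 1 = f := by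
    intro f hf
    ext i
    by_cases h : i = c
    · subst h; simp; omega
    · simp [h]
  refine Finset.sum_bij' (fun f _ => f - Pi.single c 1) (fun g _ => g + Pi.single c 1) ?_ ?_ ?_ ?_ ?_
  · intro f hf
    simp only [mem_filter, mem_piAntidiag] at hf ⊢
    obtain ⟨⟨h1, h2⟩, h3⟩ := hf
    refine ⟨?_, ?_⟩
    · have := key f h3
      rw [← this] at h1
      simp only [Pi.add_apply, sum_add_distrib] at h1
      rw [Finset.sum_pi_single'] at h1
      simp only [hc, if_true] at h1
      exact Nat.succ_injective h1
    · intro i hi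
      apply h2
      intro h
      simp [h] at hi
  · intro g hg
    simp only [mem_filter, mem_piAntidiag] at hg ⊢
    obtain ⟨h1, h2⟩ := hg
    refine ⟨⟨?_, ?_⟩, by simp⟩
    · simp only [Pi.add_apply, sum_add_distrib]
      rw [Finset.sum_pi_single']
      simp [hc, h1]
    · intro i hi
      by_cases h : i = c
      · subst h; exact hc
      · apply h2; simpa [h] using hi
  · intro f hf
    simp only [mem_filter] at hf
    exact key f hf.2
  · intro g hg
    simp
  · intro f hf
    simp only [mem_filter] at hf
    simp only [key f hf.2]

lemma sum_peel {ι : Type*} [DecidableEq ι] (S : Finset ι) (T : ℕ) (b : ι) (hb : b ∉ S)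
    (G : (ι → ℕ) → ℕ) :
    ∑ f ∈ piAntidiag (insert b S) (T+1), G f
      = ∑ f ∈ piAntidiag S (T+1), G f + ∑ g ∈ piAntidiag (insert b S) T, G (g + Pi.single b 1) := by
  rw [← sum_ne_zero_shift (insert b S) T b (mem_insert_self _ _) G,
    ← Finset.sum_filter_add_sum_filter_not (piAntidiag (insert b S) (T+1)) (fun f => f b = 0)]
  congr 1
  apply Finset.sum_congr _ (fun _ _ => rfl)
  ext f
  simp only [mem_filter, mem_piAntidiag, sum_insert hb, mem_insert]
  constructor
  · rintro ⟨⟨h1, h2⟩, h3⟩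
    rw [h3, zero_add] at h1
    refine ⟨h1, fun i hi => ?_⟩
    rcases h2 i hi with h | h
    · subst h; exact absurd h3 hi
    · exact h
  · rintro ⟨h1, h2⟩
    have : f b = 0 := by
      by_contra h
      exact hb (h2 b h)
    exact ⟨⟨by rw [this, zero_add]; exact h1, fun i hi => Or.inr (h2 i hi)⟩, this⟩

lemma sum_shift {ι : Type*} [DecidableEq ι] (S : Finset ι) (T : ℕ) (c : ι) (hc : c ∈ S)
    (G : (ι → ℕ) → ℕ) :
    ∑ f ∈ piAntidiag S (T+1), f c * G f
      = ∑ g ∈ piAntidiag S T, (g c + 1) * G (g + Pi.single c 1) := by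
  have := sum_ne_zero_shift S T c hc (fun f => f c * G f)
  simp only [Pi.add_apply, Pi.single_eq_same] at this
  rw [← this, Finset.sum_filter]
  apply Finset.sum_congr rfl
  intro f _
  split_ifs with h
  · rfl
  · simp at h; simp [h]

lemma cnt_peel {ι : Type*} [DecidableEq ι] (M : Set (ι → ℕ)) (S : Finset ι) (T : ℕ) (b : ι)
    (hb : b ∉ S) :
    cnt M (insert b S) (T+1) = cnt M S (T+1) + cnt (colon M b) (insert b S) T := by
  classical
  simp only [cnt]
  convert sum_peel S T b hb (fun f => if f ∈ M then 1 else 0) using 2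
  apply Finset.sum_congr rfl
  intro g _
  rfl

open Classical in
/-- double counting identity -/
lemma cnt_double {ι : Type*} [DecidableEq ι] (M : Set (ι → ℕ)) (S : Finset ι) (T : ℕ) :
    (T + 1) * cnt M S (T+1)
      = ∑ g ∈ piAntidiag S T, ∑ c ∈ S, (g c + 1) * (if g + Pi.single c 1 ∈ M then 1 else 0) := by
  rw [Finset.sum_comm]
  have h := fun c (hc : c ∈ S) => sum_shift S T c hc (fun f => if f ∈ M then 1 else 0)
  rw [cnt]
  have h2 : ∀ c ∈ S, ∑ g ∈ piAntidiag S T, (g c + 1) * (if g + Pi.single c 1 ∈ M then 1 else 0)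
      = ∑ f ∈ piAntidiag S (T+1), f c * (if f ∈ M then 1 else 0) := by
    intro c hc
    rw [h c hc]
  rw [Finset.sum_congr rfl h2, Finset.sum_comm, Finset.mul_sum]
  convert Finset.sum_congr rfl _ using 1
  intro f hf
  rw [← Finset.sum_mul]
  simp only [mem_piAntidiag] at hf
  rw [hf.1]

lemma cnt_univ_succ {ι : Type*} [DecidableEq ι] (S : Finset ι) (T : ℕ) :
    (T + 1) * cnt (Set.univ : Set (ι → ℕ)) S (T+1) = (T + S.card) * cnt (Set.univ : Set (ι → ℕ)) S T := by
  rw [cnt_double]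
  simp only [cnt, Set.mem_univ, if_true, mul_one, Finset.mul_sum]
  apply Finset.sum_congr (by congr!)
  intro g hg
  simp only [mem_piAntidiag] at hg
  rw [sum_add_distrib, hg.1]
  simp

lemma cnt_lym {ι : Type*} [DecidableEq ι] (M : Set (ι → ℕ)) (S : Finset ι) (T : ℕ) (b : ι)
    (hcomp : ∀ g ∈ piAntidiag S T, ∀ j ∈ S, g + Pi.single j 1 ∈ M → g + Pi.single b 1 ∈ M) :
    (T + 1) * cnt M S (T+1) ≤ (T + S.card) * cnt (colon M b) S T := by
  classical
  rw [cnt_double, cnt, Finset.mul_sum]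
  have e : ∀ s t : Finset (ι → ℕ), s = t → ∀ F G : (ι → ℕ) → ℕ, (∀ g ∈ s, F g ≤ G g) →
      ∑ g ∈ s, F g ≤ ∑ g ∈ t, G g := by
    rintro s t rfl F G h
    exact Finset.sum_le_sum h
  apply e _ _ (by congr!)
  intro g hg
  have hg' := hg
  simp only [mem_piAntidiag] at hg'
  by_cases h : g + Pi.single b 1 ∈ M
  · have : g ∈ colon M b := h
    simp only [this, if_true]
    calc _ ≤ ∑ c ∈ S, (g c + 1) := by
          apply Finset.sum_le_sum
          intro c _
          split_ifs <;> simp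
      _ = _ := by rw [sum_add_distrib, hg'.1]; simp
  · have h0 : ∀ c ∈ S, (g c + 1) * (if g + Pi.single c 1 ∈ M then 1 else 0) = 0 := by
      intro c hc
      have : ¬ (g + Pi.single c 1 ∈ M) := fun h' => h (hcomp g hg c hc h')
      simp [this]
    rw [Finset.sum_congr rfl h0]
    simp
lemma real_step (t m y z y' z' p p' : ℝ) (ht : 1 ≤ t) (hm : 0 ≤ m) (hy : 0 ≤ y) (hyz : y ≤ z)
    (hz : z ≤ 1) (hp' : 0 ≤ p')
    (h1 : t * z ≤ z' * (t - 1 + z)) (h2 : m * (y * (t + 1)) ≤ m * (y' * (t + y)))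
    (h3 : (t + m) * p = m * y + t * z) (h4 : (t + m + 1) * p' = m * y' + (t + 1) * z') :
    p * (t + 1) ≤ p' * (t + p) := by
  have hP : 0 < t + y := by linarith
  rcases (show 0 ≤ t - 1 + z by linarith).eq_or_lt with hR | hR
  · have hz0 : z = 0 := by linarith
    have hy0 : y = 0 := by linarith
    have : (t + m) * p = 0 := by rw [h3, hz0, hy0]; ring
    have hp : p = 0 := by
      rcases mul_eq_zero.1 this with h | h
      · linarith
      · exact h
    rw [hp]; nlinarith
  have k1 : t * z / (t - 1 + z) ≤ z' := by rwa [div_le_iff₀ hR]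
  have k2 : m * y * (t + 1) / (t + y) ≤ m * y' := by
    rw [div_le_iff₀ hP]; linarith
  -- polynomial inequality
  have E : 0 ≤ (m * y * (t - 1 + z) + t * z * (t + y)) * (t * t + t * m + m * y + t * z)
      - (t + m + 1) * (m * y + t * z) * (t + y) * (t - 1 + z) := by
    have e : (m * y * (t - 1 + z) + t * z * (t + y)) * (t * t + t * m + m * y + t * z)
      - (t + m + 1) * (m * y + t * z) * (t + y) * (t - 1 + z)
      = m * (t * (1 - (z - y)) * (t * (z - y)) + y * (t * (1 - (z - y)) - y * (t - 1 + z)))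
        + t * z * (t + y) * (1 - z) := by ring
    rw [e]
    have a1 : 0 ≤ t * (1 - (z - y)) * (t * (z - y)) := by
      apply mul_nonneg <;> apply mul_nonneg <;> linarith
    have a2 : y * (t - 1 + z) ≤ t * (1 - (z - y)) := by
      have : y * (t - 1 + z) ≤ (1 - (z - y)) * t := by
        apply mul_le_mul <;> linarith
      linarith
    have a3 : 0 ≤ y * (t * (1 - (z - y)) - y * (t - 1 + z)) := mul_nonneg hy (by linarith)
    have a4 : 0 ≤ t * z * (t + y) * (1 - z) := by
      apply mul_nonneg _ (by linarith)
      apply mul_nonneg (mul_nonneg _ _) <;> linarith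
    have := mul_nonneg hm (add_nonneg a1 a3)
    linarith
  have htm : 0 < t + m := by linarith
  have hp : p = (m * y + t * z) / (t + m) := by field_simp; linarith
  have hpp : (m * y * (t + 1) / (t + y) + (t + 1) * (t * z / (t - 1 + z))) / (t + m + 1) ≤ p' := by
    rw [div_le_iff₀ (by linarith)]
    have : (t + 1) * (t * z / (t - 1 + z)) ≤ (t + 1) * z' := by
      apply mul_le_mul_of_nonneg_left k1; linarith
    linarith
  have hpn : 0 ≤ t + p := by
    rw [hp]
    have : 0 ≤ (m * y + t * z) / (t + m) := by
      apply div_nonneg _ htm.le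
      have := mul_nonneg hm hy
      have : 0 ≤ t * z := mul_nonneg (by linarith) (by linarith)
      linarith
    linarith
  refine le_trans ?_ (mul_le_mul_of_nonneg_right hpp hpn)
  rw [hp]
  have hs : 0 < t + m + 1 := by linarith
  have e : (m * y * (t + 1) / (t + y) + (t + 1) * (t * z / (t - 1 + z))) / (t + m + 1)
      * (t + (m * y + t * z) / (t + m)) - (m * y + t * z) / (t + m) * (t + 1)
    = (t + 1) * ((m * y * (t - 1 + z) + t * z * (t + y)) * (t * t + t * m + m * y + t * z)
      - (t + m + 1) * (m * y + t * z) * (t + y) * (t - 1 + z)) /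
        ((t + y) * (t - 1 + z) * (t + m + 1) * (t + m)) := by
    field_simp
    ring
  have : 0 ≤ (t + 1) * ((m * y * (t - 1 + z) + t * z * (t + y)) * (t * t + t * m + m * y + t * z)
      - (t + m + 1) * (m * y + t * z) * (t + y) * (t - 1 + z)) /
        ((t + y) * (t - 1 + z) * (t + m + 1) * (t + m)) := by
    apply div_nonneg (mul_nonneg (by linarith) E)
    positivity
  linarith
/-- move inside a fibre: put `k` on `j` and the rest of `f b + f j` on `b` -/
def slide {ι : Type*} [DecidableEq ι] (b j : ι) (f : ι → ℕ) (k : ℕ) : ι → ℕ :=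
  Function.update (Function.update f j k) b (f b + f j - k)

lemma slide_b {ι : Type*} [DecidableEq ι] (b j : ι) (f : ι → ℕ) (k : ℕ) :
    slide b j f k b = f b + f j - k := by simp [slide]

lemma slide_j {ι : Type*} [DecidableEq ι] {b j : ι} (h : j ≠ b) (f : ι → ℕ) (k : ℕ) :
    slide b j f k j = k := by simp [slide, h]

lemma slide_o {ι : Type*} [DecidableEq ι] {b j c : ι} (h : c ≠ b) (h' : c ≠ j) (f : ι → ℕ) (k : ℕ) :
    slide b j f k c = f c := by simp [slide, h, h']

lemma slide_ext {ι : Type*} [DecidableEq ι] {b j : ι} (f g : ι → ℕ)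
    (hb : f b = g b) (hj : f j = g j) (h : ∀ c, c ≠ b → c ≠ j → f c = g c) : f = g := by
  ext c
  by_cases h1 : c = b
  · rw [h1, hb]
  · by_cases h2 : c = j
    · rw [h2, hj]
    · exact h c h1 h2

lemma slide_slide {ι : Type*} [DecidableEq ι] {b j : ι} (hjb : j ≠ b) (f : ι → ℕ) (k l : ℕ)
    (hk : k ≤ f b + f j) : slide b j (slide b j f k) l = slide b j f l := by
  apply slide_ext (b := b) (j := j)
  · simp only [slide_b, slide_j hjb]; omega
  · simp only [slide_j hjb]
  · intro c h1 h2; simp only [slide_o h1 h2]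

lemma slide_self {ι : Type*} [DecidableEq ι] {b j : ι} (hjb : j ≠ b) (f : ι → ℕ) :
    slide b j f (f j) = f := by
  apply slide_ext (b := b) (j := j)
  · simp only [slide_b]; omega
  · simp only [slide_j hjb]
  · intro c h1 h2; simp only [slide_o h1 h2]

lemma slide_sum {ι : Type*} [DecidableEq ι] {b j : ι} (hjb : j ≠ b) (S : Finset ι)
    (hb : b ∈ S) (hj : j ∈ S) (f : ι → ℕ) (k : ℕ) (hk : k ≤ f b + f j) :
    S.sum (slide b j f k) = S.sum f := by
  have hj' : j ∈ S.erase b := mem_erase.2 ⟨hjb, hj⟩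
  rw [← Finset.add_sum_erase S _ hb, ← Finset.add_sum_erase S f hb,
    ← Finset.add_sum_erase _ _ hj', ← Finset.add_sum_erase _ f hj', slide_b, slide_j hjb]
  have : ∑ x ∈ (S.erase b).erase j, slide b j f k x = ∑ x ∈ (S.erase b).erase j, f x := by
    apply Finset.sum_congr rfl
    intro c hc
    simp only [mem_erase] at hc
    exact slide_o hc.2.1 hc.1 f k
  rw [this]
  omega

lemma slide_mem {ι : Type*} [DecidableEq ι] {b j : ι} (hjb : j ≠ b) (S : Finset ι)
    (hb : b ∈ S) (hj : j ∈ S) (t : ℕ) (f : ι → ℕ) (hf : f ∈ piAntidiag S t)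
    (k : ℕ) (hk : k ≤ f b + f j) : slide b j f k ∈ piAntidiag S t := by
  rw [mem_piAntidiag] at hf ⊢
  refine ⟨by rw [slide_sum hjb S hb hj f k hk, hf.1], ?_⟩
  intro c hc
  by_cases h1 : c = b
  · rw [h1]; exact hb
  · by_cases h2 : c = j
    · rw [h2]; exact hj
    · rw [slide_o h1 h2] at hc
      exact hf.2 c hc

lemma sum_fibre {ι : Type*} [DecidableEq ι] {b j : ι} (hjb : j ≠ b) (S : Finset ι)
    (hb : b ∈ S) (hj : j ∈ S) (t : ℕ) (G : (ι → ℕ) → ℕ) :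
    ∑ f ∈ piAntidiag S t, G f
      = ∑ h ∈ (piAntidiag S t).filter (fun h => h j = 0), ∑ k ∈ range (h b + 1),
          G (slide b j h k) := by
  rw [Finset.sum_sigma']
  refine Finset.sum_bij' (fun f _ => (⟨slide b j f 0, f j⟩ : (_ : ι → ℕ) × ℕ))
    (fun x _ => slide b j x.1 x.2) ?_ ?_ ?_ ?_ ?_
  · intro f hf
    simp only [mem_sigma, mem_filter, mem_range, slide_b, slide_j hjb]
    exact ⟨⟨slide_mem hjb S hb hj t f hf 0 (Nat.zero_le _), trivial⟩, by omega⟩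
  · rintro ⟨h, k⟩ hx
    simp only [mem_sigma, mem_filter, mem_range] at hx ⊢
    exact slide_mem hjb S hb hj t h hx.1.1 k (by omega)
  · intro f hf
    simp only
    rw [slide_slide hjb f 0 _ (Nat.zero_le _), slide_self hjb]
  · rintro ⟨h, k⟩ hx
    simp only [mem_sigma, mem_filter, mem_range] at hx
    simp only
    rw [slide_slide hjb h k _ (by omega), slide_j hjb]
    have := slide_self hjb h
    rw [hx.1.2] at this
    rw [this]
  · intro f hf
    simp only
    rw [slide_slide hjb f 0 _ (Nat.zero_le _), slide_self hjb]

open Classical in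
/-- the fibre of `M` through `f` -/
noncomputable def fib {ι : Type*} [DecidableEq ι] (M : Set (ι → ℕ)) (b j : ι) (f : ι → ℕ) : Finset ℕ :=
  (range (f b + f j + 1)).filter (fun k => slide b j f k ∈ M)

lemma mem_fib {ι : Type*} [DecidableEq ι] (M : Set (ι → ℕ)) (b j : ι) (f : ι → ℕ) (k : ℕ) :
    k ∈ fib M b j f ↔ k ≤ f b + f j ∧ slide b j f k ∈ M := by
  simp [fib]

lemma fib_slide {ι : Type*} [DecidableEq ι] (M : Set (ι → ℕ)) {b j : ι} (hjb : j ≠ b) (f : ι → ℕ)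
    (k : ℕ) (hk : k ≤ f b + f j) : fib M b j (slide b j f k) = fib M b j f := by
  ext l
  rw [mem_fib, mem_fib, slide_slide hjb f k l hk, slide_b, slide_j hjb]
  have : f b + f j - k + k = f b + f j := by omega
  rw [this]

/-- compression -/
def compr {ι : Type*} [DecidableEq ι] (M : Set (ι → ℕ)) (b j : ι) : Set (ι → ℕ) :=
  {f | f j < (fib M b j f).card}

lemma mem_compr {ι : Type*} [DecidableEq ι] (M : Set (ι → ℕ)) (b j : ι) (f : ι → ℕ) :
    f ∈ compr M b j ↔ f j < (fib M b j f).card := Iff.rfl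

lemma compr_isUp {ι : Type*} [DecidableEq ι] (M : Set (ι → ℕ)) {b j : ι} (hjb : j ≠ b)
    (hM : IsUp M) : IsUp (compr M b j) := by
  intro f hf c
  rw [mem_compr] at hf ⊢
  have hbj : b ≠ j := hjb.symm
  by_cases hcj : c = j
  · subst hcj
    have hne : (fib M b c f).Nonempty := by
      rw [← Finset.card_pos]; omega
    set k0 := (fib M b c f).max' hne with hk0
    have hk0m : k0 ∈ fib M b c f := Finset.max'_mem _ _
    have hnot : k0 + 1 ∉ fib M b c f := by
      intro h
      have := Finset.le_max' _ _ h
      omega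
    have hsub : insert (k0 + 1) (fib M b c f) ⊆ fib M b c (f + Pi.single c 1) := by
      intro k hk
      rw [mem_insert] at hk
      rcases hk with rfl | hk
      · rw [mem_fib] at hk0m ⊢
        refine ⟨by simp [hbj]; omega, ?_⟩
        convert hM _ hk0m.2 c using 1
        apply slide_ext (b := b) (j := c)
        · simp [slide_b, hbj]; omega
        · simp [slide_j hjb]
        · intro i h1 h2; simp [slide_o h1 h2, h2]
      · rw [mem_fib] at hk ⊢
        refine ⟨by simp [hbj]; omega, ?_⟩
        convert hM _ hk.2 b using 1
        apply slide_ext (b := b) (j := c)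
        · simp [slide_b, hbj]; omega
        · simp [slide_j hjb, hjb]
        · intro i h1 h2; simp [slide_o h1 h2, h1, h2]
    have := Finset.card_le_card hsub
    rw [Finset.card_insert_of_notMem hnot] at this
    simp; omega
  · have hsub : fib M b j f ⊆ fib M b j (f + Pi.single c 1) := by
      intro k hk
      rw [mem_fib] at hk ⊢
      by_cases hcb : c = b
      · subst hcb
        refine ⟨by simp [hjb]; omega, ?_⟩
        convert hM _ hk.2 c using 1
        apply slide_ext (b := c) (j := j)
        · simp [slide_b, hjb]; omega
        · simp [slide_j hjb, hjb]
        · intro i h1 h2; simp [slide_o h1 h2, h1]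
      · refine ⟨by simp; omega, ?_⟩
        convert hM _ hk.2 c using 1
        apply slide_ext (b := b) (j := j)
        · simp [slide_b, Ne.symm hcb, Ne.symm hcj]
        · simp [slide_j hjb, Ne.symm hcj]
        · intro i h1 h2; simp [slide_o h1 h2]
    have := Finset.card_le_card hsub
    have e : (f + Pi.single c 1 : ι → ℕ) j = f j := by simp [Ne.symm hcj]
    omega

lemma sum_initial (A : Finset ℕ) : ∑ k ∈ range A.card, k + (A \ range A.card).card ≤ ∑ k ∈ A, k := by
  set R := range A.card with hR
  have hc : (A \ R).card = (R \ A).card := by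
    have h1 := Finset.card_sdiff_add_card_inter A R
    have h2 := Finset.card_sdiff_add_card_inter R A
    rw [Finset.inter_comm] at h2
    have : R.card = A.card := by simp [hR]
    omega
  have e1 := Finset.sum_inter_add_sum_sdiff A R (fun k => k)
  have e2 := Finset.sum_inter_add_sum_sdiff R A (fun k => k)
  rw [Finset.inter_comm] at e2
  have b1 : (A \ R).card * A.card ≤ ∑ k ∈ A \ R, k := by
    rw [← smul_eq_mul]
    apply Finset.card_nsmul_le_sum
    intro k hk
    simp [hR] at hk
    exact hk.2
  have b2 : ∑ k ∈ R \ A, (k + 1) ≤ (R \ A).card * A.card := by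
    rw [← smul_eq_mul]
    apply Finset.sum_le_card_nsmul
    intro k hk
    simp [hR] at hk
    omega
  rw [sum_add_distrib] at b2
  simp only [sum_const, smul_eq_mul, mul_one] at b2
  rw [← hc] at b2
  omega

lemma fib_card_le {ι : Type*} [DecidableEq ι] (M : Set (ι → ℕ)) (b j : ι) (h : ι → ℕ) :
    (fib M b j h).card ≤ h b + h j + 1 := by
  classical
  calc _ ≤ (range (h b + h j + 1)).card := Finset.card_filter_le _ _
    _ = _ := by simp

open Classical in
lemma fibre_sum_M {ι : Type*} [DecidableEq ι] (M : Set (ι → ℕ)) (b j : ι)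
    (h : ι → ℕ) (h0 : h j = 0) (F : ℕ → ℕ) :
    ∑ k ∈ range (h b + 1), (if slide b j h k ∈ M then F k else 0) = ∑ k ∈ fib M b j h, F k := by
  rw [← Finset.sum_filter, fib, h0, add_zero]

open Classical in
lemma fibre_sum_compr {ι : Type*} [DecidableEq ι] (M : Set (ι → ℕ)) {b j : ι} (hjb : j ≠ b)
    (h : ι → ℕ) (h0 : h j = 0) (F : ℕ → ℕ) :
    ∑ k ∈ range (h b + 1), (if slide b j h k ∈ compr M b j then F k else 0)
      = ∑ k ∈ range (fib M b j h).card, F k := by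
  rw [← Finset.sum_filter]
  apply Finset.sum_congr _ (fun _ _ => rfl)
  have hle := fib_card_le M b j h
  ext k
  simp only [mem_filter, mem_range, mem_compr]
  constructor
  · rintro ⟨h1, h2⟩
    rwa [fib_slide M hjb h k (by omega), slide_j hjb] at h2
  · intro h1
    refine ⟨by omega, ?_⟩
    rwa [fib_slide M hjb h k (by omega), slide_j hjb]

lemma cnt_compr {ι : Type*} [DecidableEq ι] (M : Set (ι → ℕ)) {b j : ι} (hjb : j ≠ b)
    (S : Finset ι) (hb : b ∈ S) (hj : j ∈ S) (t : ℕ) : cnt (compr M b j) S t = cnt M S t := by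
  rw [cnt, cnt, sum_fibre hjb S hb hj, sum_fibre hjb S hb hj]
  apply Finset.sum_congr rfl
  intro h hh
  have h0 := (mem_filter.1 hh).2
  rw [fibre_sum_compr M hjb h h0, fibre_sum_M M b j h h0]
  simp

open Classical in
/-- weight at one level -/
noncomputable def wtl {ι : Type*} [DecidableEq ι] (M : Set (ι → ℕ)) (S : Finset ι) (b : ι) (t : ℕ) : ℕ :=
  ∑ f ∈ piAntidiag S t, if f ∈ M then ∑ c ∈ S.erase b, f c else 0

open Classical in
lemma wtl_fibre {ι : Type*} [DecidableEq ι] (M : Set (ι → ℕ)) {b j : ι} (hjb : j ≠ b)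
    (S : Finset ι) (hb : b ∈ S) (hj : j ∈ S) (t : ℕ) :
    wtl M S b t = ∑ h ∈ (piAntidiag S t).filter (fun h => h j = 0), ∑ k ∈ range (h b + 1),
      if slide b j h k ∈ M then (k + ∑ c ∈ (S.erase b).erase j, h c) else 0 := by
  rw [wtl, sum_fibre hjb S hb hj]
  apply Finset.sum_congr rfl
  intro h hh
  apply Finset.sum_congr rfl
  intro k hk
  have hj' : j ∈ S.erase b := mem_erase.2 ⟨hjb, hj⟩
  rw [← Finset.add_sum_erase _ _ hj', slide_j hjb]
  have : ∑ x ∈ (S.erase b).erase j, slide b j h k x = ∑ x ∈ (S.erase b).erase j, h x := by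
    apply Finset.sum_congr rfl
    intro c hc
    simp only [mem_erase] at hc
    exact slide_o hc.2.1 hc.1 h k
  rw [this]

lemma wtl_fibre_le {ι : Type*} [DecidableEq ι] (M : Set (ι → ℕ)) {b j : ι} (hjb : j ≠ b)
    (S : Finset ι) (hb : b ∈ S) (hj : j ∈ S) (t : ℕ) :
    wtl (compr M b j) S b t + ∑ h ∈ (piAntidiag S t).filter (fun h => h j = 0),
      (fib M b j h \ range (fib M b j h).card).card ≤ wtl M S b t := by
  rw [wtl_fibre _ hjb S hb hj, wtl_fibre _ hjb S hb hj, ← sum_add_distrib]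
  apply Finset.sum_le_sum
  intro h hh
  have h0 := (mem_filter.1 hh).2
  rw [fibre_sum_compr M hjb h h0 (fun k => k + ∑ c ∈ (S.erase b).erase j, h c),
    fibre_sum_M M b j h h0 (fun k => k + ∑ c ∈ (S.erase b).erase j, h c), sum_add_distrib,
    sum_add_distrib]
  have := sum_initial (fib M b j h)
  simp only [sum_const, card_range]
  omega

lemma wtl_lt {ι : Type*} [DecidableEq ι] (M : Set (ι → ℕ)) {b j : ι} (hjb : j ≠ b)
    (S : Finset ι) (hb : b ∈ S) (hj : j ∈ S) (t : ℕ) (g : ι → ℕ) (hg : g ∈ piAntidiag S t)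
    (h1 : g + Pi.single j 1 ∈ M) (h2 : g + Pi.single b 1 ∉ M) :
    wtl (compr M b j) S b (t+1) < wtl M S b (t+1) := by
  have hbj : b ≠ j := hjb.symm
  have hle := wtl_fibre_le M hjb S hb hj (t+1)
  set f := g + Pi.single j 1 with hf
  have hfm : f ∈ piAntidiag S (t+1) := by
    rw [mem_piAntidiag] at hg ⊢
    refine ⟨?_, ?_⟩
    · simp only [hf, Pi.add_apply, sum_add_distrib]
      rw [Finset.sum_pi_single']
      simp [hj, hg.1]
    · intro i hi
      by_cases h : i = j
      · rw [h]; exact hj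
      · apply hg.2; simpa [hf, h] using hi
  set h := slide b j f 0 with hh
  have hmem : h ∈ (piAntidiag S (t+1)).filter (fun h => h j = 0) := by
    rw [mem_filter]
    exact ⟨slide_mem hjb S hb hj _ f hfm 0 (Nat.zero_le _), slide_j hjb f 0⟩
  have hfib : fib M b j h = fib M b j f := fib_slide M hjb f 0 (Nat.zero_le _)
  have m1 : g j + 1 ∈ fib M b j h := by
    rw [hfib, mem_fib]
    have e : f j = g j + 1 := by simp [hf]
    rw [← e, slide_self hjb]
    exact ⟨by omega, h1⟩
  have m2 : g j ∉ fib M b j h := by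
    rw [hfib, mem_fib]
    rintro ⟨-, h3⟩
    apply h2
    convert h3 using 1
    apply slide_ext (b := b) (j := j)
    · simp [slide_b, hf, hbj]; omega
    · simp [slide_j hjb, hjb]
    · intro i h1 h2; simp [slide_o h1 h2, hf, h1, h2]
  have pos : 0 < (fib M b j h \ range (fib M b j h).card).card := by
    rw [Finset.card_pos]
    by_contra hcon
    rw [Finset.not_nonempty_iff_eq_empty, Finset.sdiff_eq_empty_iff_subset] at hcon
    have := Finset.eq_of_subset_of_card_le hcon (by simp)
    have m1' : g j + 1 ∈ range (fib M b j h).card := by rw [← this]; exact m1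
    apply m2
    rw [this]
    rw [mem_range] at m1' ⊢
    omega
  have := Finset.single_le_sum (f := fun h => (fib M b j h \ range (fib M b j h).card).card)
    (fun i _ => Nat.zero_le _) hmem
  omega

lemma exists_compressed {ι : Type*} [DecidableEq ι] (S : Finset ι) (b : ι) (hb : b ∈ S) (T : ℕ) :
    ∀ (w : ℕ) (M : Set (ι → ℕ)), IsUp M → ∑ t ∈ range (T+1), wtl M S b t ≤ w →
    ∃ M' : Set (ι → ℕ), IsUp M' ∧ (∀ t, cnt M' S t = cnt M S t) ∧
      ∀ t < T, ∀ g ∈ piAntidiag S t, ∀ j ∈ S, g + Pi.single j 1 ∈ M' → g + Pi.single b 1 ∈ M' := by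
  intro w
  induction w with
  | zero =>
    intro M hM hw
    refine ⟨M, hM, fun _ => rfl, ?_⟩
    intro t ht g hg j hj h1
    by_contra h2
    have hjb : j ≠ b := by rintro rfl; exact h2 h1
    have := wtl_lt M hjb S hb hj t g hg h1 h2
    have := Finset.single_le_sum (f := fun t => wtl M S b t) (fun i _ => Nat.zero_le _)
      (mem_range.2 (show t + 1 < T + 1 by omega))
    omega
  | succ w ih =>
    intro M hM hw
    by_cases hc : ∀ t < T, ∀ g ∈ piAntidiag S t, ∀ j ∈ S, g + Pi.single j 1 ∈ M →
        g + Pi.single b 1 ∈ M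
    · exact ⟨M, hM, fun _ => rfl, hc⟩
    push Not at hc
    obtain ⟨t, ht, g, hg, j, hj, h1, h2⟩ := hc
    have hjb : j ≠ b := by rintro rfl; exact h2 h1
    have hlt : ∑ t ∈ range (T+1), wtl (compr M b j) S b t < ∑ t ∈ range (T+1), wtl M S b t := by
      apply Finset.sum_lt_sum
      · intro s _
        have := wtl_fibre_le M hjb S hb hj s
        omega
      · exact ⟨t + 1, mem_range.2 (by omega), wtl_lt M hjb S hb hj t g hg h1 h2⟩
    obtain ⟨M', a1, a2, a3⟩ := ih (compr M b j) (compr_isUp M hjb hM) (by omega)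
    exact ⟨M', a1, fun t => by rw [a2, cnt_compr M hjb S hb hj], a3⟩
lemma cnt_le_univ {ι : Type*} [DecidableEq ι] (M : Set (ι → ℕ)) (S : Finset ι) (T : ℕ) :
    cnt M S T ≤ cnt Set.univ S T := by
  apply Finset.sum_le_sum
  intro f _
  simp only [Set.mem_univ, if_true]
  split_ifs <;> simp

lemma cnt_univ_pos {ι : Type*} [DecidableEq ι] (S : Finset ι) (hS : S.Nonempty) (T : ℕ) :
    0 < cnt Set.univ S T := by
  induction T with
  | zero => simp [cnt]
  | succ T ih =>
    have h := cnt_univ_succ S T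
    have : 0 < (T + S.card) * cnt Set.univ S T :=
      Nat.mul_pos (by have := hS.card_pos; omega) ih
    rw [← h] at this
    exact Nat.pos_of_mul_pos_left this

lemma cnt_zero {ι : Type*} [DecidableEq ι] (M : Set (ι → ℕ)) (S S' : Finset ι) :
    cnt M S 0 = cnt M S' 0 := by
  simp [cnt]

lemma compressed_step {ι : Type*} [DecidableEq ι] (S : Finset ι) (b : ι) (hb : b ∉ S) (T : ℕ)
    (M : Set (ι → ℕ))
    (hc : ∀ t < T + 1, ∀ g ∈ piAntidiag (insert b S) t, ∀ j ∈ insert b S,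
      g + Pi.single j 1 ∈ M → g + Pi.single b 1 ∈ M)
    (ih : cnt (colon M b) S T * cnt Set.univ (insert b S) T
      ≤ cnt (colon M b) (insert b S) T * cnt Set.univ S T) :
    cnt M S (T+1) * cnt Set.univ (insert b S) T
      ≤ cnt (colon M b) (insert b S) T * cnt Set.univ S (T+1) := by
  have h1 := cnt_lym M S T b (by
    intro g hg j hj h
    refine hc T (by omega) g ?_ j (mem_insert_of_mem hj) h
    rw [mem_piAntidiag] at hg ⊢
    have : g b = 0 := by
      by_contra h; exact hb (hg.2 b h)
    refine ⟨?_, fun i hi => mem_insert_of_mem (hg.2 i hi)⟩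
    rw [sum_insert hb, this, zero_add]
    exact hg.1)
  have h2 := cnt_univ_succ S T
  refine Nat.le_of_mul_le_mul_left ?_ (Nat.succ_pos T)
  calc (T+1) * (cnt M S (T+1) * cnt Set.univ (insert b S) T)
      = ((T+1) * cnt M S (T+1)) * cnt Set.univ (insert b S) T := by ring
    _ ≤ ((T + S.card) * cnt (colon M b) S T) * cnt Set.univ (insert b S) T :=
        Nat.mul_le_mul_right _ h1
    _ = (T + S.card) * (cnt (colon M b) S T * cnt Set.univ (insert b S) T) := by ring
    _ ≤ (T + S.card) * (cnt (colon M b) (insert b S) T * cnt Set.univ S T) :=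
        Nat.mul_le_mul_left _ ih
    _ = cnt (colon M b) (insert b S) T * ((T + S.card) * cnt Set.univ S T) := by ring
    _ = (T+1) * (cnt (colon M b) (insert b S) T * cnt Set.univ S (T+1)) := by rw [← h2]; ring

lemma colon_univ {ι : Type*} [DecidableEq ι] (b : ι) : colon (Set.univ : Set (ι → ℕ)) b = Set.univ := by
  ext; simp [colon]

lemma colon_compressed {ι : Type*} [DecidableEq ι] (S : Finset ι) (b : ι) (hb : b ∈ S) (T : ℕ)
    (M : Set (ι → ℕ))
    (hc : ∀ t < T + 1, ∀ g ∈ piAntidiag S t, ∀ j ∈ S,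
      g + Pi.single j 1 ∈ M → g + Pi.single b 1 ∈ M) :
    ∀ t < T, ∀ g ∈ piAntidiag S t, ∀ j ∈ S,
      g + Pi.single j 1 ∈ colon M b → g + Pi.single b 1 ∈ colon M b := by
  intro t ht g hg j hj h
  have h' : g + Pi.single j 1 + Pi.single b 1 ∈ M := h
  rw [add_right_comm] at h'
  refine hc (t+1) (by omega) (g + Pi.single b 1) ?_ j hj h'
  rw [mem_piAntidiag] at hg ⊢
  refine ⟨?_, ?_⟩
  · simp only [Pi.add_apply, sum_add_distrib]
    rw [Finset.sum_pi_single']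
    simp [hb, hg.1]
  · intro i hi
    by_cases h : i = b
    · rw [h]; exact hb
    · apply hg.2; simpa [h] using hi

lemma compressed_le {ι : Type*} [DecidableEq ι] (S : Finset ι) (b : ι) (hb : b ∉ S) (T : ℕ) :
    ∀ (M : Set (ι → ℕ)),
    (∀ t < T, ∀ g ∈ piAntidiag (insert b S) t, ∀ j ∈ insert b S,
      g + Pi.single j 1 ∈ M → g + Pi.single b 1 ∈ M) →
    cnt M S T * cnt Set.univ (insert b S) T ≤ cnt M (insert b S) T * cnt Set.univ S T := by
  induction T with
  | zero =>
    intro M _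
    rw [cnt_zero M S (insert b S), cnt_zero Set.univ S (insert b S)]
  | succ T ih =>
    intro M hc
    have h := compressed_step S b hb T M hc
      (ih _ (colon_compressed _ b (mem_insert_self _ _) T M hc))
    rw [cnt_peel M S T b hb, cnt_peel Set.univ S T b hb, colon_univ]
    nlinarith

/-- density -/
noncomputable def lvlDens {ι : Type*} [DecidableEq ι] (M : Set (ι → ℕ)) (S : Finset ι) (T : ℕ) : ℝ :=
  (cnt M S T : ℝ) / cnt Set.univ S T

lemma dens_nonneg {ι : Type*} [DecidableEq ι] (M : Set (ι → ℕ)) (S : Finset ι) (T : ℕ) :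
    0 ≤ lvlDens M S T := by unfold lvlDens; positivity

lemma dens_le_one {ι : Type*} [DecidableEq ι] (M : Set (ι → ℕ)) (S : Finset ι) (T : ℕ) :
    lvlDens M S T ≤ 1 := by
  unfold lvlDens
  apply div_le_one_of_le₀ _ (by positivity)
  exact_mod_cast cnt_le_univ M S T

lemma dens_peel {ι : Type*} [DecidableEq ι] (M : Set (ι → ℕ)) (S : Finset ι) (T : ℕ) (b : ι)
    (hb : b ∉ S) :
    ((T : ℝ) + 1 + S.card) * lvlDens M (insert b S) (T+1)
      = S.card * lvlDens M S (T+1) + (T + 1) * lvlDens (colon M b) (insert b S) T := by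
  have hp := cnt_peel M S T b hb
  have hN := cnt_peel Set.univ S T b hb
  rw [colon_univ] at hN
  have hN2 := cnt_univ_succ (insert b S) T
  rw [card_insert_of_notMem hb] at hN2
  have pos1 := cnt_univ_pos (insert b S) (insert_nonempty _ _) (T+1)
  have pos0 := cnt_univ_pos (insert b S) (insert_nonempty _ _) T
  unfold lvlDens
  rw [hp]
  push_cast
  have hN' : (cnt Set.univ (insert b S) (T+1) : ℝ)
      = cnt Set.univ S (T+1) + cnt Set.univ (insert b S) T := by exact_mod_cast hN
  have hN2' : ((T:ℝ)+1) * cnt Set.univ (insert b S) (T+1)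
      = (T + (S.card + 1)) * cnt Set.univ (insert b S) T := by exact_mod_cast hN2
  have pos1' : (0:ℝ) < cnt Set.univ (insert b S) (T+1) := by exact_mod_cast pos1
  have pos0' : (0:ℝ) < cnt Set.univ (insert b S) T := by exact_mod_cast pos0
  have e1 : ((T:ℝ) + 1) * ((cnt (colon M b) (insert b S) T : ℝ) / cnt Set.univ (insert b S) T)
      = ((T:ℝ) + 1 + S.card) * (cnt (colon M b) (insert b S) T / cnt Set.univ (insert b S) (T+1)) := by
    field_simp
    linear_combination (cnt (colon M b) (insert b S) T : ℝ) * hN2'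
  have e2 : (S.card : ℝ) * ((cnt M S (T+1) : ℝ) / cnt Set.univ S (T+1))
      = ((T:ℝ) + 1 + S.card) * (cnt M S (T+1) / cnt Set.univ (insert b S) (T+1)) := by
    rcases S.eq_empty_or_nonempty with rfl | hne
    · have : cnt M ∅ (T+1) = 0 := by simp [cnt]
      simp [this]
    · have posS : (0:ℝ) < cnt Set.univ S (T+1) := by exact_mod_cast cnt_univ_pos S hne (T+1)
      field_simp
      have : (S.card : ℝ) * cnt Set.univ (insert b S) (T+1)
          = (T + 1 + S.card) * cnt Set.univ S (T+1) := by
        linear_combination ((T:ℝ) + 1 + S.card) * hN' - hN2'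
      linear_combination (cnt M S (T+1) : ℝ) * this
  rw [e1, e2]
  ring

lemma colon_isUp {ι : Type*} [DecidableEq ι] (M : Set (ι → ℕ)) (b : ι) (hM : IsUp M) :
    IsUp (colon M b) := by
  intro f hf c
  have : f + Pi.single b 1 + Pi.single c 1 ∈ M := hM _ hf c
  rw [add_right_comm] at this
  exact this

lemma dens_step_zero {ι : Type*} [DecidableEq ι] (M : Set (ι → ℕ)) (hM : IsUp M) (S : Finset ι)
    (hS : S.Nonempty) :
    lvlDens M S 0 * (((0 : ℕ) : ℝ) + 1) ≤ lvlDens M S (0+1) * (((0 : ℕ) : ℝ) + lvlDens M S 0) := by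
  by_cases h0 : (0 : ι → ℕ) ∈ M
  · have e : cnt M S (0+1) = cnt Set.univ S (0+1) := by
      have h1 := cnt_double M S 0
      have h2 := cnt_double Set.univ S 0
      simp only [zero_add, one_mul] at h1 h2 ⊢
      rw [h1, h2]
      apply Finset.sum_congr rfl
      intro g hg
      apply Finset.sum_congr rfl
      intro c _
      have hg0 : g = 0 := by simpa using hg
      have := hM 0 h0 c
      rw [hg0]
      simp only [this, Set.mem_univ, if_true]
    have : lvlDens M S (0+1) = 1 := by
      unfold lvlDens
      rw [e]
      apply div_self
      have := cnt_univ_pos S hS (0+1)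
      positivity
    rw [this]; simp
  · have : lvlDens M S 0 = 0 := by simp [lvlDens, cnt, h0]
    rw [this]; simp

theorem dens_step {ι : Type*} [DecidableEq ι] (S : Finset ι) : S.Nonempty → ∀ (T : ℕ)
    (M : Set (ι → ℕ)), IsUp M →
    lvlDens M S T * ((T : ℝ) + 1) ≤ lvlDens M S (T+1) * ((T : ℝ) + lvlDens M S T) := by
  induction S using Finset.induction_on with
  | empty => intro h; exact absurd h (by simp)
  | insert b S hb ihS =>
    intro hne T
    induction T with
    | zero => intro M hM; exact dens_step_zero M hM _ hne
    | succ T ih =>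
      intro M₀ hM₀
      obtain ⟨M, hM, hcnt, hc⟩ := exists_compressed (insert b S) b (mem_insert_self _ _) (T+1) _ M₀
        hM₀ le_rfl
      have hd : ∀ t, lvlDens M₀ (insert b S) t = lvlDens M (insert b S) t := by
        intro t; unfold lvlDens; rw [hcnt]
      rw [hd, hd]
      have hyz0 := compressed_step S b hb T M hc
        (compressed_le S b hb T _ (colon_compressed _ b (mem_insert_self _ _) T M hc))
      have hyz : lvlDens M S (T+1) ≤ lvlDens (colon M b) (insert b S) T := by
        rcases S.eq_empty_or_nonempty with rfl | hS
        · have : lvlDens M ∅ (T+1) = 0 := by simp [lvlDens, cnt]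
          rw [this]; exact dens_nonneg _ _ _
        · unfold lvlDens
          have p1 := cnt_univ_pos S hS (T+1)
          have p2 := cnt_univ_pos (insert b S) hne T
          rw [div_le_div_iff₀ (by exact_mod_cast p1) (by exact_mod_cast p2)]
          exact_mod_cast hyz0
      have h1 := ih (colon M b) (colon_isUp M b hM)
      have h3 := dens_peel M S T b hb
      have h4 := dens_peel M S (T+1) b hb
      push_cast at h4 ⊢
      apply real_step ((T:ℝ) + 1) S.card (lvlDens M S (T+1)) (lvlDens (colon M b) (insert b S) T)
        (lvlDens M S (T+1+1)) (lvlDens (colon M b) (insert b S) (T+1))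
      · have : (0:ℝ) ≤ T := by positivity
        linarith
      · positivity
      · exact dens_nonneg _ _ _
      · exact hyz
      · exact dens_le_one _ _ _
      · exact dens_nonneg _ _ _
      · rw [add_sub_cancel_right]; linarith
      · rcases S.eq_empty_or_nonempty with rfl | hS
        · simp
        · apply mul_le_mul_of_nonneg_left _ (by positivity)
          have := ihS hS (T+1) M hM
          push_cast at this
          exact this
      · exact h3
      · linarith

lemma prob_eq_dens {B : Type*} [Fintype B] [DecidableEq B] (T : ℕ) (M : Set (B → ℕ)) :
    uniformProb B T M = lvlDens M Finset.univ T := by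
  classical
  have key : ∀ M : Set (B → ℕ), ((Fintype.piFinset fun _ : B => Finset.range (T + 1)).filter
        (fun f => (∑ b, f b) = T ∧ f ∈ M)).card = cnt M Finset.univ T := by
    intro M
    rw [cnt, ← Finset.sum_filter, Finset.card_eq_sum_ones]
    apply Finset.sum_congr _ (fun _ _ => rfl)
    ext f
    simp only [mem_filter, Fintype.mem_piFinset, mem_range, mem_piAntidiag, mem_univ, implies_true,
      and_true]
    constructor
    · rintro ⟨-, h⟩; exact h
    · intro h
      refine ⟨fun i => ?_, h⟩
      have := Finset.single_le_sum (f := f) (fun i _ => Nat.zero_le _) (mem_univ i)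
      have h1 : ∑ b, f b = T := h.1
      omega
  have k2 := key Set.univ
  simp only [Set.mem_univ, and_true] at k2
  unfold uniformProb lvlDens
  rw [← key M, ← k2]
  congr!

lemma cond_iff (p x : ℝ) (T : ℕ) (hp1 : p ≤ 1) (hx : 0 ≤ x) :
    p ≤ (if T = 0 ∧ x = 0 then 1 else (T : ℝ) / (T + x)) ↔ x * p ≤ T * (1 - p) := by
  split_ifs with h
  · obtain ⟨rfl, rfl⟩ := h
    simp [hp1]
  · have hT : (0:ℝ) ≤ T := by positivity
    have : 0 < (T:ℝ) + x := by
      rcases hT.eq_or_lt with h0 | h0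
      · rcases hx.eq_or_lt with h1 | h1
        · exact absurd ⟨by exact_mod_cast h0.symm, h1.symm⟩ h
        · linarith
      · linarith
    rw [le_div_iff₀ this]
    constructor <;> intro h <;> linarith

theorem stmt_3 (B : Type*) [Fintype B] [Nonempty B] (M : Set (B → ℕ))
    (hM : ∀ x ∈ M, ∀ y : B → ℕ, x ≤ y → y ∈ M)
    (T U : ℕ) (hUT : U ≤ T) (x : ℝ) (hx : 0 ≤ x)
    (h : uniformProb B T M ≤ (if T = 0 ∧ x = 0 then 1 else (T : ℝ) / (T + x))) :
    uniformProb B U M ≤ (if U = 0 ∧ x = 0 then 1 else (U : ℝ) / (U + x)) := by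
  classical
  have hUp : IsUp M := by
    intro f hf c
    apply hM f hf
    intro i
    simp
  rw [prob_eq_dens, cond_iff _ _ _ (dens_le_one _ _ _) hx] at h ⊢
  induction T, hUT using Nat.le_induction with
  | base => exact h
  | succ T hUT ih =>
    apply ih
    have hs := dens_step (Finset.univ : Finset B) univ_nonempty T M hUp
    push_cast at h
    have p0 := dens_nonneg M Finset.univ T
    have p1 := dens_le_one M Finset.univ T
    have q0 := dens_nonneg M Finset.univ (T+1)
    set p := lvlDens M Finset.univ T
    set p' := lvlDens M Finset.univ (T+1)
    have hT : (0:ℝ) ≤ T := by positivity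
    rcases p0.eq_or_lt with hp | hp
    · rw [← hp]; simp
    have hp' : 0 < p' := by
      rcases q0.eq_or_lt with h0 | h0
      · rw [← h0, zero_mul] at hs
        have : 0 < p * ((T:ℝ) + 1) := by positivity
        linarith
      · exact h0
    have h5 : x * p' * p ≤ ((T:ℝ) + 1) * (1 - p') * p := mul_le_mul_of_nonneg_right h p0
    have : (x * p) * p' ≤ ((T:ℝ) * (1 - p)) * p' := by nlinarith
    exact le_of_mul_le_mul_right this hp'
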